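/- arXiv:2403.08116 — 6 statements merged into one kernel-verified Lean document; each statement's English description precedes it below -/
import Mathlib

section
/- For every integer n ≥ 2 and every real number ε with 0 ≤ ε < 1/2, the set of extreme points of the Goodwillie polytope G_n^ε is exactly V_{n,ε}; in particular G_n^ε has exactly 2^{n−2}·(n+3) vertices. -/
open Set

noncomputable section

/-- The vertex set `{0,1}ⁿ` of the unit cube in `ℝⁿ`. -/
def Vcube (n : ℕ) : Set (Fin n → ℝ) := {x | ∀ j, x j = 0 ∨ x j = 1}

/-- The set `U_{n,ε}` of extra vertices of the Goodwillie polytope.  Here the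
index `i : Fin n` with `i ≠ 0` corresponds to the coordinate subscript
`i + 1 ∈ {2,…,n}`, so the first coordinate `(subscript − 1)/n` equals `i/n`. -/
def Uset (n : ℕ) [NeZero n] (ε : ℝ) : Set (Fin n → ℝ) :=
  {x | ∃ i : Fin n, i ≠ 0 ∧ x 0 = ((i : ℕ) : ℝ) / (n : ℝ) ∧ x i = -1 ∧
        ∀ j : Fin n, j ≠ 0 → j ≠ i → (x j = ε ∨ x j = 1 - ε)}

/-- The Goodwillie polytope `G_n^ε`: the convex hull of `V_{n,ε} = V_cube ∪ U_{n,ε}`. -/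
def Gpoly (n : ℕ) [NeZero n] (ε : ℝ) : Set (Fin n → ℝ) :=
  convexHull ℝ (Vcube n ∪ Uset n ε)

/-- A point `p` of `S` that maximizes the coordinate functional `s k • x k`, and that dominates
coordinatewise (up to the signs of `s`) every point of `S` where this maximum is attained, is an
extreme point of the convex hull of `S`. -/
theorem mem_extremePoints_convexHull_of_lex {ι : Type*} {S : Set (ι → ℝ)} {p : ι → ℝ}
    (hp : p ∈ S) (k : ι) (s : ι → ℝ) (hs : ∀ j, s j ≠ 0)
    (h : ∀ x ∈ S, s k * x k < s k * p k ∨ (x k = p k ∧ ∀ j, s j * x j ≤ s j * p j)) :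
    p ∈ (convexHull ℝ S).extremePoints ℝ := by
  have hull : ∀ x ∈ convexHull ℝ S,
      s k * x k < s k * p k ∨ (x k = p k ∧ ∀ j, s j * x j ≤ s j * p j) := by
    suffices hconv : Convex ℝ {x : ι → ℝ |
        s k * x k < s k * p k ∨ (x k = p k ∧ ∀ j, s j * x j ≤ s j * p j)} from
      fun x hx => convexHull_min h hconv hx
    refine convex_iff_forall_pos.2 ?_
    intro y hy z hz a b ha hb hab
    have combo : ∀ j, s j * (a • y + b • z) j = a * (s j * y j) + b * (s j * z j) := by
      intro j
      simp only [Pi.add_apply, Pi.smul_apply, smul_eq_mul]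
      ring
    have split : ∀ j, s j * p j = a * (s j * p j) + b * (s j * p j) := by
      intro j
      rw [← add_mul, hab, one_mul]
    rw [mem_ofPred_eq, combo k]
    rcases hy with hy | ⟨hyk, hy⟩ <;> rcases hz with hz | ⟨hzk, hz⟩
    · left
      rw [split k]
      gcongr
    · left
      rw [split k, hzk]
      gcongr
    · left
      rw [split k, hyk]
      gcongr
    · refine Or.inr ⟨?_, fun j => ?_⟩
      · simp only [Pi.add_apply, Pi.smul_apply, smul_eq_mul, hyk, hzk]
        rw [← add_mul, hab, one_mul]
      · rw [combo j, split j]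
        exact add_le_add (mul_le_mul_of_nonneg_left (hy j) ha.le)
          (mul_le_mul_of_nonneg_left (hz j) hb.le)
  refine mem_extremePoints_iff_left.2 ⟨subset_convexHull ℝ S hp, ?_⟩
  rintro y hy z hz ⟨a, b, ha, hb, hab, hpyz⟩
  have combo : ∀ j, a * (s j * p j - s j * y j) + b * (s j * p j - s j * z j) = 0 := by
    intro j
    have hj := congrFun hpyz j
    simp only [Pi.add_apply, Pi.smul_apply, smul_eq_mul] at hj
    linear_combination s j * p j * hab - s j * hj
  have le_max : ∀ x ∈ convexHull ℝ S, s k * x k ≤ s k * p k := by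
    intro x hx
    rcases hull x hx with hlt | ⟨heq, -⟩
    exacts [hlt.le, by rw [heq]]
  have hyk := le_max y hy
  have hzk := le_max z hz
  have hy' := (hull y hy).resolve_left fun hlt => by
    linarith [combo k, mul_pos ha (sub_pos.2 hlt), mul_nonneg hb.le (sub_nonneg.2 hzk)]
  have hz' := (hull z hz).resolve_left fun hlt => by
    linarith [combo k, mul_pos hb (sub_pos.2 hlt), mul_nonneg ha.le (sub_nonneg.2 hyk)]
  funext j
  refine mul_left_cancel₀ (hs j) (le_antisymm (hy'.2 j) ?_)
  by_contra! hlt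
  linarith [combo j, mul_pos ha (sub_pos.2 hlt), mul_nonneg hb.le (sub_nonneg.2 (hz'.2 j))]

theorem Uset_zero_mem_Ioo {n : ℕ} [NeZero n] {ε : ℝ} {x : Fin n → ℝ} (hx : x ∈ Uset n ε) :
    x 0 ∈ Ioo (0 : ℝ) 1 := by
  obtain ⟨i, hi, hx0, -⟩ := hx
  have hn : (0 : ℝ) < n := by exact_mod_cast Nat.pos_of_neZero n
  have hi' : (0 : ℝ) < (i : ℕ) := by exact_mod_cast Fin.pos_iff_ne_zero.2 hi
  rw [hx0]
  exact ⟨div_pos hi' hn, (div_lt_one hn).2 (by exact_mod_cast i.isLt)⟩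

theorem Vcube_disjoint_Uset (n : ℕ) [NeZero n] (ε : ℝ) : Disjoint (Vcube n) (Uset n ε) := by
  refine Set.disjoint_left.2 fun x hV hU => ?_
  have h := Uset_zero_mem_Ioo hU
  rcases hV 0 with h0 | h0 <;> rw [h0] at h
  exacts [lt_irrefl _ h.1, lt_irrefl _ h.2]

theorem Vcube_subset_extremePoints (n : ℕ) [NeZero n] (ε : ℝ) :
    Vcube n ⊆ (Gpoly n ε).extremePoints ℝ := by
  intro p hp
  refine mem_extremePoints_convexHull_of_lex (Or.inl hp) 0 (fun j => p j - 1 / 2) ?_ ?_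
  · intro j
    rcases hp j with h | h <;> norm_num [h]
  · rintro x (hx | hx)
    · have hle : ∀ j, (p j - 1 / 2) * x j ≤ (p j - 1 / 2) * p j := by
        intro j
        rcases hp j with h | h <;> rcases hx j with h' | h' <;> norm_num [h, h']
      by_cases h0 : x 0 = p 0
      · exact Or.inr ⟨h0, hle⟩
      · refine Or.inl (lt_of_le_of_ne (hle 0) fun h => h0 (mul_left_cancel₀ ?_ h))
        rcases hp 0 with h | h <;> norm_num [h]
    · obtain ⟨h0, h1⟩ := Uset_zero_mem_Ioo hx
      left
      rcases hp 0 with h | h <;> simp only [h] <;> linarith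

theorem Uset_subset_extremePoints (n : ℕ) [NeZero n] {ε : ℝ} (hε0 : 0 ≤ ε) (hε1 : ε < 1 / 2) :
    Uset n ε ⊆ (Gpoly n ε).extremePoints ℝ := by
  rintro p ⟨i, hi, hp0, hpi, hpj⟩
  refine mem_extremePoints_convexHull_of_lex (Or.inr ⟨i, hi, hp0, hpi, hpj⟩) i
    (fun j => if j = 0 then 1 else p j - 1 / 2) ?_ ?_
  · intro j
    split_ifs with hj
    · exact one_ne_zero
    · by_cases hji : j = i
      · rw [hji, hpi]
        norm_num
      · rcases hpj j hj hji with h | h <;> rw [h] <;> intro h' <;> linarith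
  · have hlt : ∀ x : Fin n → ℝ, 0 ≤ x i →
        (if i = 0 then 1 else p i - 1 / 2) * x i < (if i = 0 then 1 else p i - 1 / 2) * p i := by
      intro x hx
      rw [if_neg hi, hpi]
      linarith
    rintro x (hx | ⟨i', hi', hx0, hxi, hxj⟩)
    · refine Or.inl (hlt x ?_)
      rcases hx i with h | h <;> norm_num [h]
    · by_cases hii : i = i'
      · subst hii
        refine Or.inr ⟨hxi.trans hpi.symm, fun j => ?_⟩
        by_cases hj : j = 0
        · rw [hj, hx0, hp0]
        · by_cases hji : j = i
          · rw [hji, hxi, hpi]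
          · rw [if_neg hj]
            rcases hpj j hj hji with h | h <;> rcases hxj j hj hji with h' | h' <;>
              rw [h, h'] <;> nlinarith
      · refine Or.inl (hlt x ?_)
        rcases hxj i hi hii with h | h <;> rw [h] <;> linarith

theorem Vcube_eq_piFinset (n : ℕ) :
    Vcube n = (Fintype.piFinset fun _ : Fin n => ({0, 1} : Finset ℝ) : Set (Fin n → ℝ)) := by
  ext x
  simp [Vcube]

theorem ncard_Vcube (n : ℕ) : (Vcube n).ncard = 2 ^ n := by
  rw [Vcube_eq_piFinset, ncard_coe_finset, Fintype.card_piFinset]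
  simp

/-- The possible values of the coordinate `j` of a point of `Uset n ε` with distinguished
coordinate `i`. -/
def Ucoord (n : ℕ) [NeZero n] (ε : ℝ) (i j : Fin n) : Finset ℝ :=
  if j = 0 then {((i : ℕ) : ℝ) / n} else if j = i then {-1} else {ε, 1 - ε}

theorem Uset_eq_biUnion (n : ℕ) [NeZero n] (ε : ℝ) :
    Uset n ε = ((Finset.univ.erase 0).biUnion fun i => Fintype.piFinset (Ucoord n ε i) :
      Finset (Fin n → ℝ)) := by
  ext x
  simp only [Uset, mem_ofPred_eq, Finset.coe_biUnion, Finset.coe_erase, Finset.coe_univ,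
    mem_iUnion, Finset.mem_coe, Fintype.mem_piFinset, exists_prop, mem_sdiff, mem_univ,
    true_and, mem_singleton_iff]
  refine exists_congr fun i => and_congr_right fun hi => ?_
  constructor
  · rintro ⟨h0, h1, h2⟩ j
    unfold Ucoord
    split_ifs with hj hji
    · simp [hj, h0]
    · simp [hji, h1]
    · simpa using h2 j hj hji
  · intro h
    refine ⟨by simpa [Ucoord] using h 0, by simpa [Ucoord, hi] using h i, fun j hj hji => ?_⟩
    simpa [Ucoord, hj, hji] using h j

theorem card_piFinset_Ucoord {n : ℕ} [NeZero n] {ε : ℝ} (hε1 : ε < 1 / 2) {i : Fin n}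
    (hi : i ≠ 0) : (Fintype.piFinset (Ucoord n ε i)).card = 2 ^ (n - 2) := by
  have hne : ε ≠ 1 - ε := by
    intro h
    linarith
  have hcard : ∀ j ∈ (Finset.univ.erase (0 : Fin n)).erase i, (Ucoord n ε i j).card = 2 := by
    intro j hj
    simp only [Finset.mem_erase, Finset.mem_univ, and_true] at hj
    rw [Ucoord, if_neg hj.2, if_neg hj.1, Finset.card_pair hne]
  have hmem : i ∈ Finset.univ.erase (0 : Fin n) := by simpa using hi
  rw [Fintype.card_piFinset, ← Finset.mul_prod_erase _ _ (Finset.mem_univ (0 : Fin n)),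
    ← Finset.mul_prod_erase _ _ hmem, Finset.prod_congr rfl hcard, Finset.prod_const,
    Finset.card_erase_of_mem hmem, Finset.card_erase_of_mem (Finset.mem_univ _)]
  simp [Ucoord, hi, Nat.sub_sub]

theorem ncard_Uset (n : ℕ) [NeZero n] {ε : ℝ} (hε1 : ε < 1 / 2) :
    (Uset n ε).ncard = (n - 1) * 2 ^ (n - 2) := by
  rw [Uset_eq_biUnion, ncard_coe_finset, Finset.card_biUnion]
  · rw [Finset.sum_congr rfl fun i hi => card_piFinset_Ucoord hε1 (Finset.ne_of_mem_erase hi)]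
    simp
  · intro i _ i' _ hii
    refine Finset.disjoint_left.2 fun x hx hx' => hii ?_
    have h : x 0 = ((i : ℕ) : ℝ) / n := by simpa [Ucoord] using Fintype.mem_piFinset.1 hx 0
    have h' : x 0 = ((i' : ℕ) : ℝ) / n := by simpa [Ucoord] using Fintype.mem_piFinset.1 hx' 0
    have hn : (n : ℝ) ≠ 0 := Nat.cast_ne_zero.2 (NeZero.ne n)
    exact Fin.ext (by exact_mod_cast (div_left_inj' hn).1 (h.symm.trans h'))

/-- for `n ≥ 2` and `0 ≤ ε < 1/2`, the set of extreme points of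
the Goodwillie polytope `G_n^ε` is exactly `V_{n,ε} = V_cube ∪ U_{n,ε}`;
in particular `G_n^ε` has exactly `2^{n−2}·(n+3)` vertices. -/
theorem stmt2 (n : ℕ) [NeZero n] (hn : 2 ≤ n) (ε : ℝ) (hε0 : 0 ≤ ε) (hε1 : ε < 1 / 2) :
    (Gpoly n ε).extremePoints ℝ = Vcube n ∪ Uset n ε ∧
      ((Gpoly n ε).extremePoints ℝ).ncard = 2 ^ (n - 2) * (n + 3) := by
  have hext : (Gpoly n ε).extremePoints ℝ = Vcube n ∪ Uset n ε :=
    extremePoints_convexHull_subset.antisymm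
      (union_subset (Vcube_subset_extremePoints n ε) (Uset_subset_extremePoints n hε0 hε1))
  refine ⟨hext, ?_⟩
  have hV : (Vcube n).Finite := Vcube_eq_piFinset n ▸ Finset.finite_toSet _
  have hU : (Uset n ε).Finite := Uset_eq_biUnion n ε ▸ Finset.finite_toSet _
  rw [hext, ncard_union_eq (Vcube_disjoint_Uset n ε) hV hU, ncard_Vcube, ncard_Uset n hε1]
  obtain ⟨m, rfl⟩ := Nat.exists_eq_add_of_le' hn
  simp only [Nat.add_sub_cancel, Nat.add_succ_sub_one]
  ring
end
end

section
/- For every integer n ≥ 2 and every subset S ⊆ {2,…,n}, the piece G_n^{0,S} of the Goodwillie polytope G_n^0 equals the convex hull of the finite set V_{n,0} ∩ G_n^{0,S}. -/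
open Set

noncomputable section

/-- The piece `G_n^{ε,S}` of the Goodwillie polytope, for `S ⊆ {2,…,n}`
(encoded as a finset of nonzero indices of `Fin n`). -/
def Gpiece (n : ℕ) [NeZero n] (ε : ℝ) (S : Finset (Fin n)) : Set (Fin n → ℝ) :=
  {x ∈ Gpoly n ε | (∀ i ∈ S, x i ≤ 0) ∧ ∀ i : Fin n, i ≠ 0 → i ∉ S → 0 ≤ x i}

/-- A linear inequality with nonnegative coefficients on the coordinates in `S` holds on the
whole polytope `G_n^0` as soon as it holds at the extremal vertices. -/
lemma Gpoly_zero_nonneg {n : ℕ} [NeZero n] {S : Finset (Fin n)} (hS : (0 : Fin n) ∉ S)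
    {a b : ℝ} {c : Fin n → ℝ} (hc : ∀ i, 0 ≤ c i) (hb : 0 ≤ b) (hab : 0 ≤ b + a)
    (hcb : ∀ i : Fin n, i ≠ 0 → c i ≤ b + a * (((i : ℕ) : ℝ) / n))
    {x : Fin n → ℝ} (hx : x ∈ Gpoly n 0) : 0 ≤ b + (a * x 0 + ∑ i ∈ S, c i * x i) := by
  let f : (Fin n → ℝ) →ₗ[ℝ] ℝ :=
    a • LinearMap.proj 0 + ∑ i ∈ S, c i • (LinearMap.proj i : (Fin n → ℝ) →ₗ[ℝ] ℝ)
  have hf (y : Fin n → ℝ) : f y = a * y 0 + ∑ i ∈ S, c i * y i := by simp [f]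
  have hconv : Convex ℝ {y | -b ≤ f y} := convex_halfSpace_ge f.isLinear _
  have hsub : Vcube n ∪ Uset n 0 ⊆ {y | -b ≤ f y} := by
    rintro y (hy | ⟨k, hk, h0, hyk, hy⟩) <;> rw [mem_ofPred_eq, hf]
    · have hsum : 0 ≤ ∑ i ∈ S, c i * y i := Finset.sum_nonneg fun i _ =>
        mul_nonneg (hc i) (by rcases hy i with h | h <;> simp [h])
      rcases hy 0 with h | h <;> rw [h] <;> linarith
    · have hsum : ∑ i ∈ S, (if i = k then -c k else 0) ≤ ∑ i ∈ S, c i * y i := by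
        refine Finset.sum_le_sum fun i hi => ?_
        split_ifs with hik
        · simp [hik, hyk]
        · refine mul_nonneg (hc i) ?_
          rcases hy i (fun h => hS (h ▸ hi)) hik with h | h <;> simp [h]
      have hle : -c k ≤ ∑ i ∈ S, (if i = k then -c k else 0) := by
        rw [Finset.sum_ite_eq']
        split_ifs
        · exact le_rfl
        · linarith [hc k]
      rw [h0]
      linarith [hcb k hk]
  have := convexHull_min hsub hconv hx
  rw [mem_ofPred_eq, hf] at this
  linarith

lemma Gpoly_zero_le_one {n : ℕ} [NeZero n] {j : Fin n} (hj : j ≠ 0)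
    {x : Fin n → ℝ} (hx : x ∈ Gpoly n 0) : x j ≤ 1 := by
  refine convexHull_min (t := {y : Fin n → ℝ | y j ≤ 1}) ?_
    (convex_halfSpace_le (LinearMap.proj j : (Fin n → ℝ) →ₗ[ℝ] ℝ).isLinear 1) hx
  rintro y (hy | ⟨k, -, -, hyk, hy⟩)
  · rcases hy j with h | h <;> simp [h]
  · rcases eq_or_ne j k with rfl | hjk
    · simp [hyk]
    · rcases hy j hj hjk with h | h <;> simp [h]

/-- The point of `ℝⁿ` with first coordinate `t`, with coordinates in `S` equal to `0`, except for
`-1` at `i`, and with the remaining coordinates those of `x`. -/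
def slicePoint {n : ℕ} [NeZero n] (S : Finset (Fin n)) (x : Fin n → ℝ) (t : ℝ) (i : Fin n) :
    Fin n → ℝ :=
  fun j => if j = 0 then t else if j ∈ S then (if j = i then -1 else 0) else x j

lemma slicePoint_mem_convexHull {n : ℕ} [NeZero n] {S : Finset (Fin n)} (hS : (0 : Fin n) ∉ S)
    {x : Fin n → ℝ} (hx : ∀ j, j ≠ 0 → j ∉ S → x j ∈ Icc (0 : ℝ) 1) {t : ℝ} {i : Fin n}
    (hi : (i = 0 ∧ t ∈ Icc (0 : ℝ) 1) ∨ (i ∈ S ∧ t = ((i : ℕ) : ℝ) / n)) :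
    slicePoint S x t i ∈ convexHull ℝ ((Vcube n ∪ Uset n 0) ∩ Gpiece n 0 S) := by
  let T : Fin n → Set ℝ := fun j =>
    if j = 0 then (if i = 0 then {0, 1} else {t})
    else if j ∈ S then {if j = i then -1 else 0} else {0, 1}
  have h01 : convexHull ℝ ({0, 1} : Set ℝ) = Icc 0 1 := by
    rw [convexHull_pair, segment_eq_Icc zero_le_one]
  have hmem : slicePoint S x t i ∈ convexHull ℝ (univ.pi T) := by
    rw [convexHull_pi]
    intro j _
    simp only [slicePoint, T]
    split_ifs with hj hi0 hjS hji
    · rw [h01]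
      rcases hi with h | h
      · exact h.2
      · exact absurd (hi0 ▸ h.1) hS
    · simp
    · simp
    · simp
    · rw [h01]
      exact hx j hj hjS
  refine convexHull_mono (fun y hy => ?_) hmem
  have hy0 := hy 0 (mem_univ _)
  have hyS (j : Fin n) (hj : j ∈ S) : y j = if j = i then -1 else 0 := by
    have := hy j (mem_univ _)
    have hj0 : j ≠ 0 := fun h => hS (h ▸ hj)
    simpa [T, hj0, hj] using this
  have hyN (j : Fin n) (hj0 : j ≠ 0) (hj : j ∉ S) : y j = 0 ∨ y j = 1 := by
    have := hy j (mem_univ _)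
    simpa [T, hj0, hj] using this
  have hV : y ∈ Vcube n ∪ Uset n 0 := by
    rcases hi with ⟨rfl, -⟩ | ⟨hiS, ht⟩
    · left
      intro j
      rcases eq_or_ne j 0 with rfl | hj0
      · simpa [T] using hy0
      · by_cases hj : j ∈ S
        · simp [hyS j hj, hj0]
        · exact hyN j hj0 hj
    · right
      have hi0 : i ≠ 0 := fun h => hS (h ▸ hiS)
      refine ⟨i, hi0, ?_, by simp [hyS i hiS], fun j hj0 hji => ?_⟩
      · rw [← ht]
        simpa [T, hi0] using hy0
      · by_cases hj : j ∈ S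
        · simp [hyS j hj, hji]
        · simpa using hyN j hj0 hj
  refine ⟨hV, subset_convexHull ℝ _ hV, fun j hj => ?_, fun j hj0 hj => ?_⟩
  · rw [hyS j hj]
    split_ifs <;> norm_num
  · rcases hyN j hj0 hj with h | h <;> simp [h]

lemma convex_Gpiece (n : ℕ) [NeZero n] (ε : ℝ) (S : Finset (Fin n)) :
    Convex ℝ (Gpiece n ε S) := by
  rintro x ⟨hx, hxS, hxN⟩ y ⟨hy, hyS, hyN⟩ a b ha hb hab
  refine ⟨convex_convexHull ℝ _ hx hy ha hb hab, fun i hi => ?_, fun i hi0 hi => ?_⟩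
  · simpa using add_nonpos (mul_nonpos_of_nonneg_of_nonpos ha (hxS i hi))
      (mul_nonpos_of_nonneg_of_nonpos hb (hyS i hi))
  · simpa using add_nonneg (mul_nonneg ha (hxN i hi0 hi)) (mul_nonneg hb (hyN i hi0 hi))

/-- for `n ≥ 2` and `S ⊆ {2,…,n}`, the piece `G_n^{0,S}` of the
Goodwillie polytope `G_n^0` equals the convex hull of `V_{n,0} ∩ G_n^{0,S}`. -/
theorem stmt4 (n : ℕ) [NeZero n] (hn : 2 ≤ n) (S : Finset (Fin n)) (hS : (0 : Fin n) ∉ S) :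
    Gpiece n 0 S = convexHull ℝ ((Vcube n ∪ Uset n 0) ∩ Gpiece n 0 S) := by
  refine Subset.antisymm ?_ (convexHull_min inter_subset_right (convex_Gpiece n 0 S))
  rintro x ⟨hxG, hxS, hxN⟩
  have hn0 : (0 : ℝ) < n := by exact_mod_cast (by omega : 0 < n)
  have hfrac (i : Fin n) : 0 ≤ ((i : ℕ) : ℝ) / n := by positivity
  have hfrac_le (i : Fin n) : ((i : ℕ) : ℝ) / n ≤ 1 := by
    rw [div_le_one hn0]
    exact_mod_cast i.2.le
  have hlower := Gpoly_zero_nonneg hS (a := 1) (b := 0) (c := fun i => ((i : ℕ) : ℝ) / n)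
    hfrac le_rfl (by norm_num) (fun i _ => by simp) hxG
  have hupper := Gpoly_zero_nonneg hS (a := -1) (b := 1) (c := fun i => 1 - ((i : ℕ) : ℝ) / n)
    (fun i => by linarith [hfrac_le i]) zero_le_one (by norm_num) (fun i _ => by linarith) hxG
  have hmass := Gpoly_zero_nonneg hS (a := 0) (b := 1) (c := fun _ => 1)
    (fun _ => zero_le_one) zero_le_one (by norm_num) (fun i _ => by simp) hxG
  simp only [sub_mul, one_mul, zero_mul, zero_add, Finset.sum_sub_distrib]
    at hlower hupper hmass
  set w : ℝ := 1 + ∑ i ∈ S, x i with hw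
  set r : ℝ := x 0 + ∑ i ∈ S, ((i : ℕ) : ℝ) / n * x i with hr
  have hrw : r ≤ w := by linarith
  have hwr : w * (r / w) = r := by
    rcases eq_or_ne w 0 with h | h
    · rw [h, zero_mul]
      linarith
    · field_simp
  have hxIcc : ∀ j, j ≠ 0 → j ∉ S → x j ∈ Icc (0 : ℝ) 1 := fun j hj0 hj =>
    ⟨hxN j hj0 hj, Gpoly_zero_le_one hj0 hxG⟩
  have hne {i : Fin n} (hi : i ∈ S) : i ≠ 0 := fun h => hS (h ▸ hi)
  let lam : Fin n → ℝ := fun i => if i = 0 then w else -x i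
  let p : Fin n → Fin n → ℝ := fun i =>
    slicePoint S x (if i = 0 then r / w else ((i : ℕ) : ℝ) / n) i
  have hsplit (g : Fin n → ℝ) :
      ∑ i ∈ insert 0 S, lam i * g i = w * g 0 - ∑ i ∈ S, x i * g i := by
    rw [Finset.sum_insert hS, sub_eq_add_neg, ← Finset.sum_neg_distrib]
    congr 1
    exact Finset.sum_congr rfl fun i hi => by simp [lam, hne hi]
  have hlam : ∑ i ∈ insert 0 S, lam i = 1 := by
    have := hsplit fun _ => 1
    simp only [mul_one] at this
    rw [this, hw]
    ring
  have hcomb : ∑ i ∈ insert 0 S, lam i • p i = x := by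
    funext j
    simp only [Finset.sum_apply, Pi.smul_apply, smul_eq_mul]
    rcases eq_or_ne j 0 with rfl | hj0
    · rw [hsplit fun i => p i 0]
      have hsum : ∑ i ∈ S, x i * p i 0 = ∑ i ∈ S, ((i : ℕ) : ℝ) / n * x i :=
        Finset.sum_congr rfl fun i hi => by simp [p, slicePoint, hne hi, mul_comm]
      have hp0 : p 0 0 = r / w := by simp [p, slicePoint]
      rw [hsum, hp0, hwr, hr]
      ring
    · by_cases hj : j ∈ S
      · rw [hsplit fun i => p i j]
        simp [p, slicePoint, hj0, hj]
      · have hp (i : Fin n) : p i j = x j := by simp [p, slicePoint, hj0, hj]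
        simp only [hp]
        rw [← Finset.sum_mul, hlam, one_mul]
  rw [← hcomb]
  refine (convex_convexHull ℝ _).sum_mem (fun i hi => ?_) hlam fun i hi => ?_
  · rcases Finset.mem_insert.1 hi with rfl | hi
    · simpa [lam] using hmass
    · simpa [lam, hne hi] using hxS i hi
  · refine slicePoint_mem_convexHull hS hxIcc ?_
    rcases Finset.mem_insert.1 hi with rfl | hi
    · left
      simpa using And.intro (div_nonneg hlower hmass) (div_le_one_of_le₀ hrw hmass)
    · right
      exact ⟨hi, if_neg (hne hi)⟩
end
end

section
/- Let n ≥ 2 and let S = {s_1 < s_2 < … < s_r} ⊆ {2,…,n}, and let j_1 < … < j_{n−r−1} be the elements of {2,…,n} \ S. Let Φ_S : ℝⁿ → ℝⁿ be the linear coordinate permutation x ↦ (x_1, x_{s_1}, …, x_{s_r}, x_{j_1}, …, x_{j_{n−r−1}}). Then the image Φ_S(G_n^{0,S}) equals the product T_S × [0,1]^{n−r−1} ⊆ ℝ^{r+1} × ℝ^{n−r−1}, where T_S ⊆ ℝ^{r+1} is the convex hull of the r+2 points consisting of the origin, the first standard basis vector e_1, and the points ((s_j−1)/n)·e_1 − e_{1+j}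 for j = 1, …, r. In particular, G_n^{0,S} is affinely isomorphic to the product of an (r+1)-dimensional simplex and an (n−r−1)-dimensional cube. -/
open Set

noncomputable section

/-- A weighted sum whose only possible negative entry is `x i = -1` is at least `-c i`. -/
lemma neg_weight_le_sum {ι : Type*} [DecidableEq ι] (S : Finset ι) {c x : ι → ℝ}
    (hc : ∀ j, 0 ≤ c j) {i : ι} (hi : x i = -1) (hx : ∀ j ∈ S, j ≠ i → 0 ≤ x j) :
    -c i ≤ ∑ j ∈ S, c j * x j := by
  calc -c i ≤ ∑ j ∈ S, if j = i then -c i else 0 := by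
        rw [Finset.sum_ite_eq' S i]
        split_ifs
        · exact le_rfl
        · linarith [hc i]
    _ ≤ ∑ j ∈ S, c j * x j := by
        refine Finset.sum_le_sum fun j hj => ?_
        split_ifs with h
        · subst h
          rw [hi]
          linarith
        · exact mul_nonneg (hc j) (hx j hj h)

/-- To bound an affine form `a * x 0 + ∑ j ∈ S, c j * x j` from below on the polytope `G_n^0`,
where `S` avoids the first coordinate and `c ≥ 0`, it suffices to bound `a * x 0` on the cube and
`a * x 0 - c i` at the extra vertices. -/
lemma le_of_mem_Gpoly_zero {n : ℕ} [NeZero n] {S : Finset (Fin n)} (hS : (0 : Fin n) ∉ S)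
    {c : Fin n → ℝ} (hc : ∀ j, 0 ≤ c j) {a b : ℝ} (h0 : b ≤ 0) (h1 : b ≤ a)
    (hi : ∀ i : Fin n, b ≤ a * ((i : ℕ) / n) - c i) {x : Fin n → ℝ} (hx : x ∈ Gpoly n 0) :
    b ≤ a * x 0 + ∑ j ∈ S, c j * x j := by
  let f : (Fin n → ℝ) →ₗ[ℝ] ℝ :=
    a • LinearMap.proj (0 : Fin n) + ∑ j ∈ S, c j • LinearMap.proj j
  have hf : ∀ x : Fin n → ℝ, f x = a * x 0 + ∑ j ∈ S, c j * x j := fun x => by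
    simp [f, LinearMap.sum_apply]
  have hsub : Vcube n ∪ Uset n 0 ⊆ {x | b ≤ f x} := by
    rintro v (hv | ⟨i, -, hv0, hvi, hv⟩) <;> rw [mem_ofPred_eq, hf]
    · have : 0 ≤ ∑ j ∈ S, c j * v j := Finset.sum_nonneg fun j _ =>
        mul_nonneg (hc j) (by rcases hv j with h | h <;> simp [h])
      rcases hv 0 with h | h <;> rw [h] <;> linarith
    · have := neg_weight_le_sum S hc hvi fun j hj hji => by
        rcases hv j (fun h => hS (h ▸ hj)) hji with h | h <;> simp [h]
      rw [hv0]
      linarith [hi i]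
  have := convexHull_min hsub (convex_halfSpace_ge f.isLinear b) hx
  rwa [mem_ofPred_eq, hf] at this

lemma le_one_of_mem_Gpoly_zero {n : ℕ} [NeZero n] {i : Fin n} (hi : i ≠ 0)
    {x : Fin n → ℝ} (hx : x ∈ Gpoly n 0) : x i ≤ 1 := by
  have hsub : Vcube n ∪ Uset n 0 ⊆ {x | (LinearMap.proj i : (Fin n → ℝ) →ₗ[ℝ] ℝ) x ≤ 1} := by
    rintro v (hv | ⟨k, -, -, hvk, hv⟩)
    · rcases hv i with h | h <;> simp [h]
    · by_cases hik : i = k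
      · subst hik
        simp only [mem_ofPred_eq, LinearMap.proj_apply, hvk]
        norm_num
      · rcases hv i hi hik with h | h <;> simp [h]
  exact convexHull_min hsub (convex_halfSpace_le (LinearMap.isLinear _) 1) hx

/-- The defining inequalities of the simplex spanned by `0`, `e₁` and the points
`w j • e₁ - e_{1+j}`. -/
lemma mem_convexHull_simplex {r : ℕ} (w : Fin r → ℝ) {a : ℝ} {y : Fin r → ℝ}
    (hy : ∀ j, y j ≤ 0) (hlow : 0 ≤ a + ∑ j, w j * y j)
    (hupp : a - ∑ j, (1 - w j) * y j ≤ 1) :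
    (Fin.cons a y : Fin (r + 1) → ℝ) ∈ convexHull ℝ
      (({0, Pi.single 0 1} : Set (Fin (r + 1) → ℝ)) ∪ Set.range (fun j : Fin r =>
        w j • (Pi.single (0 : Fin (r + 1)) (1 : ℝ) : Fin (r + 1) → ℝ) -
          (Pi.single (j.succ : Fin (r + 1)) (1 : ℝ) : Fin (r + 1) → ℝ))) := by
  set A := (({0, Pi.single 0 1} : Set (Fin (r + 1) → ℝ)) ∪ Set.range (fun j : Fin r =>
        w j • (Pi.single (0 : Fin (r + 1)) (1 : ℝ) : Fin (r + 1) → ℝ) -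
          (Pi.single (j.succ : Fin (r + 1)) (1 : ℝ) : Fin (r + 1) → ℝ))) with hA
  let weight : Option (Option (Fin r)) → ℝ
    | none => 1 - (a - ∑ j, (1 - w j) * y j)
    | some none => a + ∑ j, w j * y j
    | some (some j) => -y j
  let vertex : Option (Option (Fin r)) → (Fin (r + 1) → ℝ)
    | none => 0
    | some none => Pi.single 0 1
    | some (some j) => w j • Pi.single 0 1 - Pi.single j.succ 1
  have hsplit : ∑ j, (1 - w j) * y j = ∑ j, y j - ∑ j, w j * y j := by
    rw [← Finset.sum_sub_distrib]
    exact Finset.sum_congr rfl fun j _ => by ring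
  have hmem : ∑ k, weight k • vertex k ∈ convexHull ℝ A := by
    refine (convex_convexHull ℝ A).sum_mem ?_ ?_ ?_
    · rintro (_ | _ | j) -
      · simpa [weight] using hupp
      · exact hlow
      · exact neg_nonneg.2 (hy j)
    · simp only [Fintype.sum_option, weight, Finset.sum_neg_distrib, hsplit]
      ring
    · rintro (_ | _ | j) - <;> apply subset_convexHull
      · simp [hA, vertex]
      · simp [hA, vertex]
      · exact Or.inr ⟨j, rfl⟩
  convert hmem using 1
  ext k
  refine Fin.cases ?_ (fun i => ?_) k
  · simp [Fintype.sum_option, weight, vertex, Finset.sum_apply, mul_comm]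
  · simp [Fintype.sum_option, weight, vertex, Finset.sum_apply, Pi.single_apply]

lemma sum_orderEmbOfFin {α : Type*} [LinearOrder α] {S : Finset α} {r : ℕ} (hr : S.card = r)
    (f : α → ℝ) : ∑ j, f (S.orderEmbOfFin hr j) = ∑ i ∈ S, f i := by
  conv_rhs => rw [← Finset.map_orderEmbOfFin_univ S hr, Finset.sum_map]
  rfl

/-- The unit cube is the convex hull of its vertices. -/
lemma forall_mem_Icc_iff_mem_convexHull {ι : Type*} [Finite ι] (y : ι → ℝ) :
    (∀ k, y k ∈ Icc (0 : ℝ) 1) ↔ y ∈ convexHull ℝ {v : ι → ℝ | ∀ k, v k = 0 ∨ v k = 1} := by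
  have : {v : ι → ℝ | ∀ k, v k = 0 ∨ v k = 1} = univ.pi fun _ => {0, 1} := by
    ext v
    simp [Set.mem_pi]
  rw [this, convexHull_pi]
  simp only [convexHull_pair, segment_eq_Icc zero_le_one, Set.mem_pi, mem_univ, true_imp_iff]

/-- A point of `ℝⁿ` is freely prescribed by its first coordinate, its coordinates in `S` and its
remaining coordinates. -/
lemma exists_eq_on_blocks {n r m : ℕ} [NeZero n] {S Sc : Finset (Fin n)} (hS : (0 : Fin n) ∉ S)
    (hr : S.card = r) (hm : Sc.card = m) (h0 : (0 : Fin n) ∉ Sc) (hd : Disjoint S Sc)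
    (a : ℝ) (y : Fin r → ℝ) (z : Fin m → ℝ) :
    ∃ x : Fin n → ℝ, x 0 = a ∧ (∀ j, x (S.orderEmbOfFin hr j) = y j) ∧
      ∀ k, x (Sc.orderEmbOfFin hm k) = z k := by
  refine ⟨fun i => if i = 0 then a else if h : i ∈ S then
      y ((S.orderIsoOfFin hr).symm ⟨i, h⟩) else if h : i ∈ Sc then
      z ((Sc.orderIsoOfFin hm).symm ⟨i, h⟩) else 0, by simp, fun j => ?_, fun k => ?_⟩
  · have hj := S.orderEmbOfFin_mem hr j
    have hne : S.orderEmbOfFin hr j ≠ 0 := fun h => hS (h ▸ hj)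
    simp only [hne, hj, if_false, dif_pos]
    congr 1
    rw [OrderIso.symm_apply_eq]
    rfl
  · have hk := Sc.orderEmbOfFin_mem hm k
    have hne : Sc.orderEmbOfFin hm k ≠ 0 := fun h => h0 (h ▸ hk)
    have hk' : Sc.orderEmbOfFin hm k ∉ S := fun h => Finset.disjoint_left.1 hd h hk
    simp only [hne, hk, hk', if_false, dif_pos, dif_neg, not_false_eq_true]
    congr 1
    rw [OrderIso.symm_apply_eq]
    rfl

lemma exists_orderEmbOfFin_eq {α : Type*} [LinearOrder α] {S : Finset α} {r : ℕ}
    (hr : S.card = r) {i : α} (hi : i ∈ S) : ∃ j, S.orderEmbOfFin hr j = i := by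
  have : i ∈ Set.range (S.orderEmbOfFin hr) := by simpa using hi
  exact this

/-- permuting coordinates maps the piece `G_n^{0,S}` onto the
product `T_S × [0,1]^{n−r−1}` of a simplex `T_S ⊆ ℝ^{r+1}` (the convex hull of
the origin, `e₁`, and the points `((s_j−1)/n)·e₁ − e_{1+j}`) with a cube.
Here `S ⊆ {2,…,n}` is encoded as a finset of nonzero indices of `Fin n`, the
index `i : Fin n` corresponding to the paper subscript `i+1`, so the paper
quantity `(s_j − 1)/n` is `(s j : ℝ)/n` below.  The complement `Sc` of
`S ∪ {1}` enumerates the cube coordinates, and we record `Sc.card = n−r−1`. -/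
theorem stmt5 (n r : ℕ) [NeZero n] (hn : 2 ≤ n) (S : Finset (Fin n))
    (hS : (0 : Fin n) ∉ S) (hr : S.card = r) :
    ∀ (Sc : Finset (Fin n)), Sc = Finset.univ.filter (fun i => i ≠ 0 ∧ i ∉ S) →
    ∀ (hSc : Sc.card = Sc.card),
    (Sc.card = n - r - 1) ∧
    (fun x : Fin n → ℝ =>
        ((Fin.cons (x 0) (fun j : Fin r => x (S.orderEmbOfFin hr j)) : Fin (r + 1) → ℝ),
          (fun k : Fin Sc.card => x (Sc.orderEmbOfFin hSc k)))) '' Gpiece n 0 S =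
      {y : (Fin (r + 1) → ℝ) × (Fin Sc.card → ℝ) |
        y.1 ∈ convexHull ℝ
          (({0, Pi.single 0 1} : Set (Fin (r + 1) → ℝ)) ∪
            Set.range (fun j : Fin r =>
              ((((S.orderEmbOfFin hr j : ℕ) : ℝ) / (n : ℝ)) •
                  (Pi.single (0 : Fin (r + 1)) (1 : ℝ) : Fin (r + 1) → ℝ) -
                (Pi.single (j.succ : Fin (r + 1)) (1 : ℝ) : Fin (r + 1) → ℝ) :
                Fin (r + 1) → ℝ))) ∧
        ∀ k, y.2 k ∈ Set.Icc (0 : ℝ) 1} := by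
  intro Sc hScdef hSc
  have hmemSc : ∀ i, i ∈ Sc ↔ i ≠ 0 ∧ i ∉ S := fun i => by simp [hScdef]
  refine ⟨?_, ?_⟩
  · have : Sc = (insert 0 S)ᶜ := by
      ext i
      simp [hmemSc]
    rw [this, Finset.card_compl, Finset.card_insert_of_notMem hS, hr, Fintype.card_fin]
    omega
  have hn0 : (0 : ℝ) < n := by exact_mod_cast (by omega : 0 < n)
  apply Subset.antisymm
  · rintro _ ⟨x, ⟨hxG, hxS, hxc⟩, rfl⟩
    refine ⟨mem_convexHull_simplex _ (fun j => hxS _ (S.orderEmbOfFin_mem hr j)) ?_ ?_,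
      fun k => ?_⟩
    · rw [sum_orderEmbOfFin hr fun i => ((i : ℕ) : ℝ) / n * x i]
      have := le_of_mem_Gpoly_zero hS (c := fun i => ((i : ℕ) : ℝ) / n) (a := 1) (b := 0)
        (fun j => by positivity) le_rfl zero_le_one (fun i => by simp) hxG
      simpa using this
    · rw [sum_orderEmbOfFin hr fun i => (1 - ((i : ℕ) : ℝ) / n) * x i]
      have := le_of_mem_Gpoly_zero hS (c := fun i => 1 - ((i : ℕ) : ℝ) / n) (a := -1) (b := -1)
        (fun j => sub_nonneg.2 ((div_le_one hn0).2 (by exact_mod_cast j.isLt.le)))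
        (by norm_num) le_rfl (fun i => by linarith) hxG
      linarith
    · obtain ⟨h0, hk⟩ := (hmemSc _).1 (Sc.orderEmbOfFin_mem hSc k)
      exact ⟨hxc _ h0 hk, le_one_of_mem_Gpoly_zero h0 hxG⟩
  · set Φ := fun x : Fin n → ℝ =>
        ((Fin.cons (x 0) (fun j : Fin r => x (S.orderEmbOfFin hr j)) : Fin (r + 1) → ℝ),
          (fun k : Fin Sc.card => x (Sc.orderEmbOfFin hSc k))) with hΦ
    have hlin : IsLinearMap ℝ Φ := by
      constructor
      · intro x y
        refine Prod.ext (funext fun i => ?_) rfl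
        refine Fin.cases ?_ (fun j => ?_) i <;> simp [hΦ]
      · intro c x
        refine Prod.ext (funext fun i => ?_) rfl
        refine Fin.cases ?_ (fun j => ?_) i <;> simp [hΦ]
    have hconv : Convex ℝ (Φ '' Gpiece n 0 S) := (convex_Gpiece n 0 S).is_linear_image hlin
    rintro ⟨p, q⟩ ⟨hp, hq⟩
    rw [forall_mem_Icc_iff_mem_convexHull] at hq
    have hpq := mk_mem_prod hp hq
    rw [← convexHull_prod] at hpq
    refine convexHull_min ?_ hconv hpq
    rintro ⟨t, c⟩ ⟨ht, hc⟩
    obtain ⟨x, hx0, hxS, hxc⟩ := exists_eq_on_blocks hS hr hSc (fun h => ((hmemSc 0).1 h).1 rfl)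
      (Finset.disjoint_left.2 fun i hi h => ((hmemSc i).1 h).2 hi) (t 0) (fun j => t j.succ) c
    have hcube : ∀ i, i ≠ 0 → i ∉ S → x i = 0 ∨ x i = 1 := fun i h0 hi => by
      obtain ⟨k, rfl⟩ := exists_orderEmbOfFin_eq hSc ((hmemSc i).2 ⟨h0, hi⟩)
      rw [hxc]
      exact hc k
    refine ⟨x, ⟨subset_convexHull ℝ _ ?_, fun i hi => ?_, fun i h0 hi => ?_⟩, ?_⟩
    · rcases ht with ht | ⟨j, rfl⟩
      · have ht0 : (t 0 = 0 ∨ t 0 = 1) ∧ ∀ j : Fin r, t j.succ = 0 := by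
          rcases ht with rfl | rfl <;> simp
        refine Or.inl fun i => ?_
        by_cases h0 : i = 0
        · rw [h0, hx0]
          exact ht0.1
        by_cases hi : i ∈ S
        · obtain ⟨j, rfl⟩ := exists_orderEmbOfFin_eq hr hi
          rw [hxS]
          exact Or.inl (ht0.2 j)
        · exact hcube i h0 hi
      · have hj := S.orderEmbOfFin_mem hr j
        refine Or.inr ⟨S.orderEmbOfFin hr j, fun h => hS (h ▸ hj), ?_, ?_, fun i h0 hij => ?_⟩
        · simp [hx0]
        · simp [hxS]
        · by_cases hi : i ∈ S
          · obtain ⟨k, rfl⟩ := exists_orderEmbOfFin_eq hr hi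
            have hkj : k ≠ j := fun h => hij (by rw [h])
            exact Or.inl (by simp [hxS, hkj])
          · simpa using hcube i h0 hi
    · obtain ⟨k, rfl⟩ := exists_orderEmbOfFin_eq hr hi
      rw [hxS]
      rcases ht with (rfl | rfl) | ⟨j, rfl⟩
      · simp
      · simp
      · simp only [Pi.sub_apply, Pi.smul_apply, Pi.single_apply]
        split_ifs <;> simp_all
    · rcases hcube i h0 hi with h | h <;> simp [h]
    · refine Prod.ext (funext fun i => ?_) (funext hxc)
      exact Fin.cases hx0 hxS i
end
end

section
/- Let n ≥ 2, 0 ≤ ε < 1/2, S ⊆ {2,…,n}, i ∈ {2,…,n} \ S, and T = S ∪ {i}. Then G_n^{ε,S} ∩ G_n^{ε,T} = {x ∈ G_n^{ε,S} : x_i = 0}, this set is nonempty (it contains the origin), and it is an exposed face of G_n^{ε,S} and also an exposed face of G_n^{ε,T}. -/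
open Set

noncomputable section

theorem zero_mem_Gpiece (n : ℕ) [NeZero n] (ε : ℝ) (S : Finset (Fin n)) :
    (0 : Fin n → ℝ) ∈ Gpiece n ε S :=
  ⟨subset_convexHull ℝ _ (Or.inl fun _ => Or.inl rfl), fun _ _ => le_rfl, fun _ _ _ => le_rfl⟩

/-- Moving the index `i` into `S` does not change the slice of the piece by `x i = 0`. -/
theorem mem_Gpiece_insert_iff_of_eq_zero {n : ℕ} [NeZero n] {ε : ℝ} {S : Finset (Fin n)}
    {i : Fin n} (hiS : i ∉ S) {x : Fin n → ℝ} (hx : x i = 0) :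
    x ∈ Gpiece n ε (insert i S) ↔ x ∈ Gpiece n ε S := by
  constructor
  · rintro ⟨hG, hle, hge⟩
    refine ⟨hG, fun j hj => hle j (Finset.mem_insert_of_mem hj), fun j hj0 hjS => ?_⟩
    by_cases hji : j = i
    · rw [hji, hx]
    · exact hge j hj0 (by simp [hji, hjS])
  · rintro ⟨hG, hle, hge⟩
    refine ⟨hG, fun j hj => ?_, fun j hj0 hj => hge j hj0 fun h => hj (Finset.mem_insert_of_mem h)⟩
    rcases Finset.mem_insert.1 hj with rfl | hj
    · exact hx.le
    · exact hle j hj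

/-- If a continuous linear functional is nonpositive on a set containing the origin, then its
zero locus in that set is an exposed face. -/
theorem isExposed_setOf_eq_zero {E : Type*} [AddCommGroup E] [Module ℝ E] [TopologicalSpace E]
    {P : Set E} (h0 : (0 : E) ∈ P) (l : E →L[ℝ] ℝ) (hl : ∀ x ∈ P, l x ≤ 0) :
    IsExposed ℝ P {x ∈ P | l x = 0} := by
  refine fun _ => ⟨l, Set.ext fun x => and_congr_right fun hx => ?_⟩
  constructor
  · intro h y hy
    rw [h]
    exact hl y hy
  · intro h
    exact le_antisymm (hl x hx) (by simpa using h 0 h0)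

/-- for `n ≥ 2`, `0 ≤ ε < 1/2`, `S ⊆ {2,…,n}`, `i ∈ {2,…,n} \ S`
and `T = S ∪ {i}`, the intersection `G_n^{ε,S} ∩ G_n^{ε,T}` equals
`{x ∈ G_n^{ε,S} : x_i = 0}`, this set contains the origin, and it is an
exposed face of both `G_n^{ε,S}` and `G_n^{ε,T}`. -/
theorem stmt7 (n : ℕ) [NeZero n] (hn : 2 ≤ n) (ε : ℝ) (hε0 : 0 ≤ ε) (hε1 : ε < 1 / 2)
    (S : Finset (Fin n)) (hS : (0 : Fin n) ∉ S) (i : Fin n) (hi0 : i ≠ 0) (hiS : i ∉ S) :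
    Gpiece n ε S ∩ Gpiece n ε (insert i S) = {x ∈ Gpiece n ε S | x i = 0} ∧
      (0 : Fin n → ℝ) ∈ {x ∈ Gpiece n ε S | x i = 0} ∧
      IsExposed ℝ (Gpiece n ε S) {x ∈ Gpiece n ε S | x i = 0} ∧
      IsExposed ℝ (Gpiece n ε (insert i S)) {x ∈ Gpiece n ε S | x i = 0} := by
  have hface : {x ∈ Gpiece n ε S | x i = 0} = {x ∈ Gpiece n ε (insert i S) | x i = 0} :=
    Set.ext fun x => and_congr_left fun hx => (mem_Gpiece_insert_iff_of_eq_zero hiS hx).symm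
  refine ⟨Set.ext fun x => ⟨?_, ?_⟩, ⟨zero_mem_Gpiece n ε S, rfl⟩, ?_, ?_⟩
  · rintro ⟨hxS, hxT⟩
    exact ⟨hxS, le_antisymm (hxT.2.1 i (Finset.mem_insert_self i S)) (hxS.2.2 i hi0 hiS)⟩
  · rintro ⟨hxS, hx⟩
    exact ⟨hxS, (mem_Gpiece_insert_iff_of_eq_zero hiS hx).2 hxS⟩
  · simpa using isExposed_setOf_eq_zero (zero_mem_Gpiece n ε S)
      (-ContinuousLinearMap.proj (R := ℝ) (φ := fun _ : Fin n => ℝ) i)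
      fun x hx => by simpa using hx.2.2 i hi0 hiS
  · rw [hface]
    exact isExposed_setOf_eq_zero (zero_mem_Gpiece n ε (insert i S))
      (ContinuousLinearMap.proj (R := ℝ) (φ := fun _ : Fin n => ℝ) i)
      fun x hx => hx.2.1 i (Finset.mem_insert_self i S)
end
end

section
/- For every integer n ≥ 2 and every subset S ⊆ {2,…,n} of cardinality r, the polytope G_n^{0,S} has exactly 2n − r facets (matching the facet count of the product Δ^{r+1} × I^{n−r−1} of an (r+1)-simplex and an (n−r−1)-cube). -/
open Set

noncomputable section

/-- A facet of a (compact convex) set `P ⊆ ℝⁿ`: a nonempty proper exposed face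
whose affine span has dimension `n − 1`. -/
def IsFacet (n : ℕ) (P F : Set (Fin n → ℝ)) : Prop :=
  F.Nonempty ∧ IsExposed ℝ P F ∧ F ≠ P ∧
    Module.finrank ℝ (affineSpan ℝ F).direction = n - 1

section Facets

variable {n : ℕ} {K : Type*}

/-- The polyhedron cut out by the inequalities `f k x ≤ b k`. -/
def polyhedron (f : K → (Fin n → ℝ) →L[ℝ] ℝ) (b : K → ℝ) : Set (Fin n → ℝ) :=
  {x | ∀ k, f k x ≤ b k}

/-- The face of `polyhedron f b` on which the inequality indexed by `k` is tight. -/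
def tightFace (f : K → (Fin n → ℝ) →L[ℝ] ℝ) (b : K → ℝ) (k : K) : Set (Fin n → ℝ) :=
  {x ∈ polyhedron f b | f k x = b k}

/-- The inequalities `f k x ≤ b k` are irredundant: each one can be tight while all the others
are strict. -/
def Irredundant (f : K → (Fin n → ℝ) →L[ℝ] ℝ) (b : K → ℝ) : Prop :=
  ∀ k, ∃ p, f k p = b k ∧ ∀ j, j ≠ k → f j p < b j

variable {f : K → (Fin n → ℝ) →L[ℝ] ℝ} {b : K → ℝ}

/-- Strict linear inequalities persist along a short segment. -/
lemma exists_pos_forall_lt_add_smul [Finite K] (T : Set K) (p v : Fin n → ℝ)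
    (h : ∀ j ∈ T, f j p < b j) : ∃ t : ℝ, 0 < t ∧ ∀ j ∈ T, f j (p + t • v) < b j := by
  have hev : ∀ᶠ t : ℝ in nhdsWithin 0 (Ioi 0), ∀ j, j ∈ T → f j (p + t • v) < b j := by
    refine Filter.eventually_all.2 fun j => ?_
    by_cases hj : j ∈ T
    · have hc : Continuous fun t : ℝ => f j (p + t • v) := by fun_prop
      have hlt : f j (p + (0 : ℝ) • v) < b j := by simpa using h j hj
      have := (hc.tendsto 0).eventually (gt_mem_nhds hlt)
      exact (this.filter_mono nhdsWithin_le_nhds).mono fun t ht _ => ht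
    · exact Filter.Eventually.of_forall fun t ht => absurd ht hj
  obtain ⟨t, ht, htpos⟩ := (hev.and self_mem_nhdsWithin).exists
  exact ⟨t, htpos, ht⟩

/-- The direction of a set on which a linear functional is constant lies in its kernel. -/
lemma direction_affineSpan_le_ker {F : Set (Fin n → ℝ)} {l : (Fin n → ℝ) →L[ℝ] ℝ}
    (h : ∀ x ∈ F, ∀ y ∈ F, l x = l y) :
    (affineSpan ℝ F).direction ≤ LinearMap.ker (l : (Fin n → ℝ) →ₗ[ℝ] ℝ) := by
  rw [direction_affineSpan, vectorSpan_def, Submodule.span_le]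
  rintro _ ⟨x, hx, y, hy, rfl⟩
  simp [h x hx y hy]

lemma finrank_ker_of_ne_zero {l : (Fin n → ℝ) →L[ℝ] ℝ} (hl : l ≠ 0) :
    Module.finrank ℝ (LinearMap.ker (l : (Fin n → ℝ) →ₗ[ℝ] ℝ)) = n - 1 := by
  have hl' : (l : (Fin n → ℝ) →ₗ[ℝ] ℝ) ≠ 0 := by
    intro h
    exact hl (ContinuousLinearMap.coe_injective h)
  have := Module.Dual.finrank_ker_add_one_of_ne_zero hl'
  rw [Module.finrank_fin_fun] at this
  omega

lemma Irredundant.ne_zero [Nontrivial K] (h : Irredundant f b) (k : K) : f k ≠ 0 := by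
  intro h0
  obtain ⟨j, hj⟩ := exists_ne k
  obtain ⟨p, hp, -⟩ := h k
  obtain ⟨q, -, hq⟩ := h j
  have := hq k hj.symm
  simp [h0] at hp this
  linarith

lemma Irredundant.isFacet_tightFace [Finite K] [Nontrivial K] (h : Irredundant f b) (k : K) :
    IsFacet n (polyhedron f b) (tightFace f b k) := by
  obtain ⟨p, hpk, hpj⟩ := h k
  have hmem : ∀ x, f k x = b k → (∀ j, j ≠ k → f j x < b j) → x ∈ tightFace f b k := by
    refine fun x hx hxj => ⟨fun j => ?_, hx⟩
    by_cases hj : j = k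
    · rw [hj, hx]
    · exact (hxj j hj).le
  have hp := hmem p hpk hpj
  refine ⟨⟨p, hp⟩, fun _ => ⟨f k, ?_⟩, ?_, ?_⟩
  · ext x
    constructor
    · rintro ⟨hx, hxk⟩
      exact ⟨hx, fun y hy => hxk ▸ hy k⟩
    · rintro ⟨hx, hmax⟩
      exact ⟨hx, le_antisymm (hx k) (hpk ▸ hmax p hp.1)⟩
  · intro heq
    obtain ⟨j, hj⟩ := exists_ne k
    obtain ⟨q, hqj, hq⟩ := h j
    have hqP : q ∈ polyhedron f b := fun i => by
      by_cases hi : i = j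
      · rw [hi, hqj]
      · exact (hq i hi).le
    rw [← heq] at hqP
    exact (hq k hj.symm).ne hqP.2
  · rw [← finrank_ker_of_ne_zero (h.ne_zero k)]
    refine congrArg (fun D : Submodule ℝ (Fin n → ℝ) => Module.finrank ℝ D) ?_
    refine le_antisymm (direction_affineSpan_le_ker fun x hx y hy => hx.2.trans hy.2.symm) ?_
    intro v hv
    have hv0 : f k v = 0 := hv
    obtain ⟨t, ht, hlt⟩ := exists_pos_forall_lt_add_smul {j | j ≠ k} p v hpj
    have hq : p + t • v ∈ tightFace f b k := hmem _ (by simp [hv0, hpk]) hlt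
    have hd : t • v ∈ (affineSpan ℝ (tightFace f b k)).direction := by
      rw [direction_affineSpan]
      simpa using vsub_mem_vectorSpan ℝ hq hp
    simpa [smul_smul, ht.ne'] using Submodule.smul_mem _ t⁻¹ hd

/-- A convex subset of a polyhedron not contained in any tight face contains a point at which
all inequalities are strict. -/
lemma exists_mem_forall_lt [Finite K] {F : Set (Fin n → ℝ)} (hF : Convex ℝ F)
    (hne : F.Nonempty) (hsub : F ⊆ polyhedron f b) (hnot : ∀ k, ∃ x ∈ F, f k x < b k) :
    ∃ x ∈ F, ∀ k, f k x < b k := by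
  classical
  have := Fintype.ofFinite K
  suffices H : ∀ T : Finset K, ∃ x ∈ F, ∀ k ∈ T, f k x < b k by
    simpa using H Finset.univ
  intro T
  induction T using Finset.induction_on with
  | empty => exact hne.imp fun x hx => ⟨hx, by simp⟩
  | insert k T _ ih =>
    obtain ⟨x, hx, hlt⟩ := ih
    obtain ⟨y, hy, hylt⟩ := hnot k
    refine ⟨(1 / 2 : ℝ) • x + (1 / 2 : ℝ) • y,
      hF hx hy (by norm_num) (by norm_num) (by norm_num), fun j hj => ?_⟩
    have h1 := hsub hx j
    have h2 := hsub hy j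
    simp only [map_add, map_smul, smul_eq_mul]
    rcases Finset.mem_insert.1 hj with rfl | hj
    · linarith
    · linarith [hlt j hj]

lemma convex_polyhedron (f : K → (Fin n → ℝ) →L[ℝ] ℝ) (b : K → ℝ) :
    Convex ℝ (polyhedron f b) := by
  simp only [polyhedron, ofPred_forall]
  exact convex_iInter fun k => convex_halfSpace_le (f k).toLinearMap.isLinear (b k)

lemma Irredundant.exists_eq_tightFace [Finite K] [Nontrivial K] (h : Irredundant f b)
    {F : Set (Fin n → ℝ)} (hF : IsFacet n (polyhedron f b) F) : ∃ k, tightFace f b k = F := by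
  obtain ⟨hne, hexp, hnP, hdim⟩ := hF
  have hconv : Convex ℝ F := hexp.convex (convex_polyhedron f b)
  obtain ⟨l, hl⟩ := hexp hne
  have hsub : F ⊆ polyhedron f b := fun x hx => by rw [hl] at hx; exact hx.1
  have hmax : ∀ x ∈ F, ∀ y ∈ polyhedron f b, l y ≤ l x := fun x hx => by
    rw [hl] at hx; exact hx.2
  have hl0 : l ≠ 0 := by
    rintro rfl
    exact hnP (by rw [hl]; simp)
  have hdl : (affineSpan ℝ F).direction = LinearMap.ker (l : (Fin n → ℝ) →ₗ[ℝ] ℝ) :=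
    Submodule.eq_of_le_of_finrank_eq
      (direction_affineSpan_le_ker fun x hx y hy =>
        le_antisymm (hmax y hy x (hsub hx)) (hmax x hx y (hsub hy)))
      (hdim.trans (finrank_ker_of_ne_zero hl0).symm)
  obtain ⟨k, hk⟩ : ∃ k, ∀ x ∈ F, f k x = b k := by
    by_contra! hcon
    obtain ⟨x, hx, hlt⟩ := exists_mem_forall_lt hconv hne hsub fun k => by
      obtain ⟨x, hx, hxk⟩ := hcon k
      exact ⟨x, hx, lt_of_le_of_ne (hsub hx k) hxk⟩
    have hle : ∀ v, l v ≤ 0 := fun v => by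
      obtain ⟨t, ht, hlt'⟩ := exists_pos_forall_lt_add_smul univ x v fun j _ => hlt j
      have := hmax x hx (x + t • v) fun j => (hlt' j (mem_univ j)).le
      simp only [map_add, map_smul, smul_eq_mul] at this
      nlinarith
    refine hl0 (ContinuousLinearMap.ext fun v => le_antisymm (hle v) ?_)
    simpa using hle (-v)
  have hdk : (affineSpan ℝ F).direction = LinearMap.ker (f k : (Fin n → ℝ) →ₗ[ℝ] ℝ) :=
    Submodule.eq_of_le_of_finrank_eq
      (direction_affineSpan_le_ker fun x hx y hy => (hk x hx).trans (hk y hy).symm)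
      (hdim.trans (finrank_ker_of_ne_zero (h.ne_zero k)).symm)
  refine ⟨k, Subset.antisymm ?_ fun x hx => ⟨hsub hx, hk x hx⟩⟩
  rintro y ⟨hyP, hyk⟩
  obtain ⟨x, hx⟩ := hne
  have hmem : y - x ∈ LinearMap.ker (l : (Fin n → ℝ) →ₗ[ℝ] ℝ) := by
    rw [← hdl, hdk]
    simp [hyk, hk x hx]
  have hlyx : l y = l x := by
    have : l (y - x) = 0 := hmem
    rwa [map_sub, sub_eq_zero] at this
  rw [hl]
  exact ⟨hyP, fun z hz => hlyx ▸ hmax x hx z hz⟩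

lemma Irredundant.tightFace_injective (h : Irredundant f b) :
    Function.Injective (tightFace f b) := by
  intro k j hkj
  by_contra hne
  obtain ⟨p, hpk, hp⟩ := h k
  have hmem : p ∈ tightFace f b k := by
    refine ⟨fun i => ?_, hpk⟩
    by_cases hi : i = k
    · rw [hi, hpk]
    · exact (hp i hi).le
  rw [hkj] at hmem
  exact (hp j (Ne.symm hne)).ne hmem.2

/-- The facets of a polyhedron given by irredundant inequalities correspond to the
inequalities. -/
theorem Irredundant.ncard_facets [Finite K] [Nontrivial K] (h : Irredundant f b) :
    {F | IsFacet n (polyhedron f b) F}.ncard = Nat.card K := by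
  have : {F | IsFacet n (polyhedron f b) F} = range (tightFace f b) := by
    ext F
    constructor
    · exact fun hF => h.exists_eq_tightFace hF
    · rintro ⟨k, rfl⟩
      exact h.isFacet_tightFace k
  rw [this, ← image_univ, ncard_image_of_injective _ h.tightFace_injective, ncard_univ]

end Facets

section Piece

variable {n : ℕ} (S : Finset (Fin n))

lemma ratio_nonneg (i : Fin n) : (0 : ℝ) ≤ (i : ℕ) / n := by positivity

lemma ratio_le_one (i : Fin n) : ((i : ℕ) / n : ℝ) ≤ 1 :=
  div_le_one_of_le₀ (by exact_mod_cast i.2.le) (by positivity)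

/-- A weighted sum over `S` of the coordinates of a vertex of the Goodwillie polytope is bounded
below by the weight of the coordinate of that vertex which may equal `-1`. -/
lemma neg_le_sum_mul {c x : Fin n → ℝ} (hc : ∀ j, 0 ≤ c j) (i : Fin n) (hi : x i = -1)
    (hx : ∀ j ∈ S, j ≠ i → 0 ≤ x j) : -c i ≤ ∑ j ∈ S, c j * x j := by
  classical
  have hle : ∑ j ∈ S, (if j = i then -c i else 0) ≤ ∑ j ∈ S, c j * x j := by
    refine Finset.sum_le_sum fun j hj => ?_
    split_ifs with h
    · rw [h, hi]; linarith
    · exact mul_nonneg (hc j) (hx j hj h)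
  rw [Finset.sum_ite_eq'] at hle
  split_ifs at hle
  · exact hle
  · linarith [hc i]

lemma mem_convexHull_of_pi_subset {V : Set (Fin n → ℝ)} {t : Fin n → Set ℝ}
    (ht : univ.pi t ⊆ V) {x : Fin n → ℝ} (hx : ∀ j, x j ∈ convexHull ℝ (t j)) :
    x ∈ convexHull ℝ V := by
  refine convexHull_mono ht ?_
  rw [convexHull_pi]
  exact fun j _ => hx j

lemma mem_convexHull_zero_one {a : ℝ} (h0 : 0 ≤ a) (h1 : a ≤ 1) :
    a ∈ convexHull ℝ ({0, 1} : Set ℝ) := by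
  rw [convexHull_pair, segment_eq_Icc zero_le_one]
  exact ⟨h0, h1⟩

variable [NeZero n]

/-- The functionals of the inequalities defining the piece indexed by `S`: the lower bounds of
the coordinates (upper bounds `x i ≤ 0` for `i ∈ S`), and the upper bounds of the coordinates
outside `S`. -/
def pieceFunctional : Fin n ⊕ {i // i ∉ S} → (Fin n → ℝ) →L[ℝ] ℝ
  | .inl i =>
    if i = 0 then
      -ContinuousLinearMap.proj 0 - ∑ i ∈ S, ((i : ℕ) / n : ℝ) • ContinuousLinearMap.proj i
    else if i ∈ S then ContinuousLinearMap.proj i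
    else -ContinuousLinearMap.proj i
  | .inr i =>
    if i.1 = 0 then
      ContinuousLinearMap.proj 0 -
        ∑ i ∈ S, (1 - (i : ℕ) / n : ℝ) • ContinuousLinearMap.proj i
    else ContinuousLinearMap.proj i.1

/-- The right-hand sides of the inequalities defining the piece indexed by `S`. -/
def pieceBound : Fin n ⊕ {i // i ∉ S} → ℝ
  | .inl _ => 0
  | .inr _ => 1

lemma mem_polyhedron_piece_iff (hS : 0 ∉ S) (x : Fin n → ℝ) :
    x ∈ polyhedron (pieceFunctional S) (pieceBound S) ↔
      -x 0 - ∑ i ∈ S, ((i : ℕ) / n : ℝ) * x i ≤ 0 ∧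
      x 0 - ∑ i ∈ S, (1 - (i : ℕ) / n : ℝ) * x i ≤ 1 ∧
      (∀ i ∈ S, x i ≤ 0) ∧ ∀ i, i ≠ 0 → i ∉ S → 0 ≤ x i ∧ x i ≤ 1 := by
  constructor
  · intro h
    refine ⟨?_, ?_, fun i hi => ?_, fun i h0 hi => ⟨?_, ?_⟩⟩
    · simpa [pieceFunctional, pieceBound] using h (.inl 0)
    · simpa [pieceFunctional, pieceBound] using h (.inr ⟨0, hS⟩)
    · have h0 : i ≠ 0 := fun h0 => hS (h0 ▸ hi)
      simpa [pieceFunctional, pieceBound, h0, hi] using h (.inl i)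
    · simpa [pieceFunctional, pieceBound, h0, hi] using h (.inl i)
    · simpa [pieceFunctional, pieceBound, h0, hi] using h (.inr ⟨i, hi⟩)
  · rintro ⟨h1, h2, h3, h4⟩ (i | ⟨i, hi⟩)
    · by_cases h0 : i = 0
      · simpa [pieceFunctional, pieceBound, h0] using h1
      · by_cases hi : i ∈ S
        · simpa [pieceFunctional, pieceBound, h0, hi] using h3 i hi
        · simpa [pieceFunctional, pieceBound, h0, hi] using (h4 i h0 hi).1
    · by_cases h0 : i = 0
      · simpa [pieceFunctional, pieceBound, h0] using h2
      · simpa [pieceFunctional, pieceBound, h0, hi] using (h4 i h0 hi).2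

lemma Gpoly_zero_subset (hS : 0 ∉ S) : Gpoly n 0 ⊆
    {x | -x 0 - ∑ i ∈ S, ((i : ℕ) / n : ℝ) * x i ≤ 0} ∩
      {x | x 0 - ∑ i ∈ S, (1 - (i : ℕ) / n : ℝ) * x i ≤ 1} ∩ {x | ∀ i, i ≠ 0 → x i ≤ 1} := by
  have hlin : ∀ (a : ℝ) (c : Fin n → ℝ),
      IsLinearMap ℝ fun x : Fin n → ℝ => a * x 0 - ∑ i ∈ S, c i * x i := by
    refine fun a c => ⟨fun x y => ?_, fun t x => ?_⟩
    · simp only [Pi.add_apply, mul_add, Finset.sum_add_distrib]; ring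
    · simp only [Pi.smul_apply, smul_eq_mul, mul_sub, Finset.mul_sum]
      congr 1
      · ring
      · exact Finset.sum_congr rfl fun i _ => by ring
  refine convexHull_min ?_ ?_
  · rintro x (hx | ⟨i, hi0, hx0, hxi, hx⟩)
    · have hx0 : ∀ j, 0 ≤ x j ∧ x j ≤ 1 := fun j => by
        rcases hx j with h | h <;> rw [h] <;> norm_num
      have h1 : 0 ≤ ∑ i ∈ S, ((i : ℕ) / n : ℝ) * x i :=
        Finset.sum_nonneg fun i _ => mul_nonneg (ratio_nonneg i) (hx0 i).1
      have h2 : 0 ≤ ∑ i ∈ S, (1 - (i : ℕ) / n : ℝ) * x i :=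
        Finset.sum_nonneg fun i _ =>
          mul_nonneg (sub_nonneg.2 (ratio_le_one i)) (hx0 i).1
      simp only [mem_inter_iff, mem_ofPred_eq]
      exact ⟨⟨by linarith [(hx0 0).1], by linarith [(hx0 0).2]⟩, fun i _ => (hx0 i).2⟩
    · have hx' : ∀ j, j ≠ 0 → j ≠ i → 0 ≤ x j ∧ x j ≤ 1 := fun j h0 hj => by
        rcases hx j h0 hj with h | h <;> rw [h] <;> norm_num
      have hxS : ∀ j ∈ S, j ≠ i → 0 ≤ x j := fun j hj =>
        fun hji => (hx' j (fun h0 => hS (h0 ▸ hj)) hji).1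
      have h1 := neg_le_sum_mul S ratio_nonneg i hxi hxS
      have h2 := neg_le_sum_mul S (fun j => sub_nonneg.2 (ratio_le_one j)) i hxi hxS
      simp only [mem_inter_iff, mem_ofPred_eq]
      refine ⟨⟨by linarith, by linarith⟩, fun j h0 => ?_⟩
      by_cases hj : j = i
      · rw [hj, hxi]; norm_num
      · exact (hx' j h0 hj).2
  · refine Convex.inter (Convex.inter ?_ ?_) ?_
    · simpa only [neg_one_mul] using convex_halfSpace_le (hlin (-1) fun i => (i : ℕ) / n) 0
    · simpa only [one_mul] using convex_halfSpace_le (hlin 1 fun i => 1 - (i : ℕ) / n) 1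
    · simp only [ofPred_forall]
      exact convex_iInter₂ fun i _ =>
        convex_halfSpace_le (LinearMap.proj (R := ℝ) (φ := fun _ : Fin n => ℝ) i).isLinear 1

lemma mem_Gpoly_of_mem_cube {x : Fin n → ℝ} (hx : ∀ j, 0 ≤ x j ∧ x j ≤ 1) (ε : ℝ) :
    x ∈ Gpoly n ε :=
  mem_convexHull_of_pi_subset (t := fun _ => {0, 1})
    (fun _ hy => .inl fun j => hy j (mem_univ j))
    fun j => mem_convexHull_zero_one (hx j).1 (hx j).2

lemma mem_Gpoly_of_apply_eq_neg_one {x : Fin n → ℝ} {i : Fin n} (hi : i ≠ 0)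
    (hx0 : x 0 = (i : ℕ) / n) (hxi : x i = -1)
    (hx : ∀ j, j ≠ 0 → j ≠ i → 0 ≤ x j ∧ x j ≤ 1) : x ∈ Gpoly n 0 := by
  refine mem_convexHull_of_pi_subset
    (t := fun j => if j = 0 then {((i : ℕ) / n : ℝ)} else if j = i then {-1} else {0, 1})
    (fun y hy => .inr ⟨i, hi, by simpa using hy 0 (mem_univ 0),
      by simpa [hi] using hy i (mem_univ i),
      fun j h0 hj => by simpa [h0, hj] using hy j (mem_univ j)⟩) fun j => ?_
  by_cases h0 : j = 0
  · simp [h0, hx0]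
  by_cases hj : j = i
  · simp [hj, hi, hxi]
  simpa only [h0, hj, if_false] using mem_convexHull_zero_one (hx j h0 hj).1 (hx j h0 hj).2

lemma mem_Gpoly_zero_of_inequalities (hS : 0 ∉ S) {x : Fin n → ℝ}
    (h1 : -x 0 - ∑ i ∈ S, ((i : ℕ) / n : ℝ) * x i ≤ 0)
    (h2 : x 0 - ∑ i ∈ S, (1 - (i : ℕ) / n : ℝ) * x i ≤ 1)
    (h3 : ∀ i ∈ S, x i ≤ 0) (h4 : ∀ i, i ≠ 0 → i ∉ S → 0 ≤ x i ∧ x i ≤ 1) :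
    x ∈ Gpoly n 0 := by
  classical
  set m : ℝ := 1 + ∑ i ∈ S, x i with hm
  set a : ℝ := x 0 + ∑ i ∈ S, ((i : ℕ) / n : ℝ) * x i with ha
  have ha0 : 0 ≤ a := by linarith
  have ham : a ≤ m := by
    simp only [sub_mul, one_mul, Finset.sum_sub_distrib] at h2
    linarith
  have hma : m * (a / m) = a := by
    rcases eq_or_ne m 0 with h | h
    · have : a = 0 := le_antisymm (h ▸ ham) ha0
      simp [h, this]
    · field_simp
  let w : Fin n → ℝ := fun j => if j = 0 then a / m else if j ∈ S then 0 else x j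
  let u : Fin n → Fin n → ℝ := fun i j =>
    if j = 0 then (i : ℕ) / n else if j ∈ S then (if j = i then -1 else 0) else x j
  have hw : w ∈ Gpoly n 0 := by
    refine mem_Gpoly_of_mem_cube (fun j => ?_) 0
    by_cases h0 : j = 0
    · simp only [w, h0, if_true]
      exact ⟨div_nonneg ha0 (ha0.trans ham), div_le_one_of_le₀ ham (ha0.trans ham)⟩
    by_cases hj : j ∈ S
    · simp [w, h0, hj]
    · simpa only [w, h0, hj, if_false] using h4 j h0 hj
  have hu : ∀ i ∈ S, u i ∈ Gpoly n 0 := by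
    intro i hi
    have hi0 : i ≠ 0 := fun h => hS (h ▸ hi)
    refine mem_Gpoly_of_apply_eq_neg_one hi0 (by simp [u]) (by simp [u, hi0, hi])
      fun j h0 hji => ?_
    by_cases hj : j ∈ S
    · simp [u, h0, hj, hji]
    · simpa only [u, h0, hj, if_false] using h4 j h0 hj
  have hx : x = ∑ i ∈ insert 0 S, (if i = 0 then m else -x i) • (if i = 0 then w else u i) := by
    rw [Finset.sum_insert hS, Finset.sum_congr rfl (g := fun i => (-x i) • u i) fun i hi => by
      simp [show i ≠ 0 from fun h => hS (h ▸ hi)]]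
    ext j
    simp only [if_true, Pi.add_apply, Finset.sum_apply, Pi.smul_apply, smul_eq_mul]
    by_cases h0 : j = 0
    · subst h0
      simp only [w, u, if_true, hma]
      rw [ha, add_assoc, ← Finset.sum_add_distrib, Finset.sum_eq_zero fun i _ => by ring, add_zero]
    by_cases hj : j ∈ S
    · simp [w, u, h0, hj]
    · simp only [w, u, h0, hj, if_false, ← Finset.sum_mul, Finset.sum_neg_distrib, hm]
      ring
  rw [hx]
  refine (convex_convexHull ℝ _).sum_mem (fun i hi => ?_) ?_ fun i hi => ?_
  · split_ifs with h
    · exact ha0.trans ham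
    · exact neg_nonneg.2 (h3 i ((Finset.mem_insert.1 hi).resolve_left h))
  · rw [Finset.sum_insert hS, Finset.sum_congr rfl (g := fun i => -x i) fun i hi => by
      simp [show i ≠ 0 from fun h => hS (h ▸ hi)]]
    simp [hm]
  · split_ifs with h
    · exact hw
    · exact hu i ((Finset.mem_insert.1 hi).resolve_left h)

theorem Gpiece_zero_eq_polyhedron (hS : 0 ∉ S) :
    Gpiece n 0 S = polyhedron (pieceFunctional S) (pieceBound S) := by
  ext x
  rw [mem_polyhedron_piece_iff S hS]
  constructor
  · rintro ⟨hx, hneg, hpos⟩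
    obtain ⟨⟨h1, h2⟩, h3⟩ := Gpoly_zero_subset S hS hx
    exact ⟨h1, h2, hneg, fun i h0 hi => ⟨hpos i h0 hi, h3 i h0⟩⟩
  · rintro ⟨h1, h2, h3, h4⟩
    exact ⟨mem_Gpoly_zero_of_inequalities S hS h1 h2 h3 h4, h3, fun i h0 hi => (h4 i h0 hi).1⟩

/-- A weighted sum of small nonpositive numbers with weights in `[0, 1]` is small. -/
lemma sum_mul_mem_Icc {c x : Fin n → ℝ} (hc : ∀ i, 0 ≤ c i ∧ c i ≤ 1)
    (hx : ∀ i ∈ S, -(1 / (4 * n)) ≤ x i ∧ x i ≤ 0) :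
    ∑ i ∈ S, c i * x i ∈ Icc (-(1 / 4) : ℝ) 0 := by
  have hn : (0 : ℝ) < n := by exact_mod_cast Nat.pos_of_neZero n
  constructor
  · have h1 : ∑ _i ∈ S, -(1 / (4 * n) : ℝ) ≤ ∑ i ∈ S, c i * x i :=
      Finset.sum_le_sum fun i hi => by nlinarith [hc i, hx i hi]
    have h2 : (S.card : ℝ) ≤ n := by exact_mod_cast S.card_le_univ.trans_eq (by simp)
    have h3 : (S.card : ℝ) * (1 / (4 * n)) ≤ n * (1 / (4 * n)) := by gcongr
    have h4 : (n : ℝ) * (1 / (4 * n)) = 1 / 4 := by field_simp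
    rw [Finset.sum_const, nsmul_eq_mul] at h1
    linarith
  · exact Finset.sum_nonpos fun i hi => mul_nonpos_of_nonneg_of_nonpos (hc i).1 (hx i hi).2

theorem irredundant_piece (hS : 0 ∉ S) : Irredundant (pieceFunctional S) (pieceBound S) := by
  classical
  have hn : (0 : ℝ) < 1 / (4 * n) := by
    have : (0 : ℝ) < n := by exact_mod_cast Nat.pos_of_neZero n
    positivity
  let c : Fin n → ℝ := fun i => if i ∈ S then -(1 / (4 * n)) else 1 / 2
  have hA : ∀ x : Fin n → ℝ, (∀ i ∈ S, -(1 / (4 * n)) ≤ x i ∧ x i ≤ 0) →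
      ∑ i ∈ S, ((i : ℕ) / n : ℝ) * x i ∈ Icc (-(1 / 4) : ℝ) 0 := fun x hx =>
    sum_mul_mem_Icc S (fun i => ⟨ratio_nonneg i, ratio_le_one i⟩) hx
  have hB : ∀ x : Fin n → ℝ, (∀ i ∈ S, -(1 / (4 * n)) ≤ x i ∧ x i ≤ 0) →
      ∑ i ∈ S, (1 - (i : ℕ) / n : ℝ) * x i ∈ Icc (-(1 / 4) : ℝ) 0 := fun x hx =>
    sum_mul_mem_Icc S (fun i =>
      ⟨sub_nonneg.2 (ratio_le_one i), sub_le_self _ (ratio_nonneg i)⟩) hx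
  have hcS : ∀ i ∈ S, -(1 / (4 * n)) ≤ c i ∧ c i ≤ 0 := fun i hi => by
    simp only [c, hi, if_true]
    exact ⟨le_rfl, by linarith⟩
  have hlow : ∀ (x : Fin n → ℝ) (j : Fin n), j ≠ 0 → x j = c j →
      pieceFunctional S (.inl j) x < 0 := fun x j h0 hj => by
    by_cases hjS : j ∈ S
    · simp only [pieceFunctional, h0, hjS, if_true, if_false, ContinuousLinearMap.proj_apply, hj, c]
      linarith
    · simp [pieceFunctional, h0, hjS, hj, c]
  have hupp : ∀ (x : Fin n → ℝ) (j : Fin n) (hjS : j ∉ S), j ≠ 0 → x j = c j →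
      pieceFunctional S (.inr ⟨j, hjS⟩) x < 1 := fun x j hjS h0 hj => by
    simp only [pieceFunctional, h0, hjS, if_false, ContinuousLinearMap.proj_apply, hj, c]
    norm_num
  have hlow0 : ∀ x : Fin n → ℝ, pieceFunctional S (.inl 0) x =
      -x 0 - ∑ i ∈ S, ((i : ℕ) / n : ℝ) * x i := fun x => by simp [pieceFunctional]
  have hupp0 : ∀ x : Fin n → ℝ, pieceFunctional S (.inr ⟨0, hS⟩) x =
      x 0 - ∑ i ∈ S, (1 - (i : ℕ) / n : ℝ) * x i := fun x => by simp [pieceFunctional]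
  have hsum : ∀ (w : Fin n → ℝ) (v : ℝ),
      ∑ i ∈ S, w i * Function.update c 0 v i = ∑ i ∈ S, w i * c i := fun w v =>
    Finset.sum_congr rfl fun i hi => by
      rw [Function.update_of_ne (ne_of_mem_of_not_mem hi hS)]
  have hc0 : c 0 = 1 / 2 := by simp [c, hS]
  obtain ⟨hA1, hA2⟩ := hA c hcS
  obtain ⟨hB1, hB2⟩ := hB c hcS
  rintro (i | ⟨i, hi⟩)
  · by_cases h0 : i = 0
    · subst h0
      refine ⟨Function.update c 0 (-∑ i ∈ S, ((i : ℕ) / n : ℝ) * c i), ?_, ?_⟩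
      · rw [hlow0, hsum]; simp [pieceBound]
      · rintro (j | ⟨j, hj⟩) hne
        · have hj0 : j ≠ 0 := fun h => hne (by rw [h])
          exact hlow _ j hj0 (Function.update_of_ne hj0 _ _)
        · by_cases hj0 : j = 0
          · subst hj0
            rw [hupp0, hsum, Function.update_self]
            simp only [pieceBound]
            linarith
          · exact hupp _ j hj hj0 (Function.update_of_ne hj0 _ _)
    · have hxS : ∀ j ∈ S, -(1 / (4 * n)) ≤ Function.update c i 0 j ∧
          Function.update c i 0 j ≤ 0 := fun j hj => by
        by_cases hji : j = i
        · subst hji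
          simp only [Function.update_self]
          exact ⟨by linarith, le_rfl⟩
        · rw [Function.update_of_ne hji]
          exact hcS j hj
      have hx0 : Function.update c i 0 0 = 1 / 2 := by
        rw [Function.update_of_ne (Ne.symm h0), hc0]
      refine ⟨Function.update c i 0, ?_, ?_⟩
      · by_cases hi : i ∈ S <;> simp [pieceFunctional, pieceBound, h0, hi]
      · rintro (j | ⟨j, hj⟩) hne
        · have hji : j ≠ i := fun h => hne (by rw [h])
          by_cases hj0 : j = 0
          · subst hj0
            rw [hlow0, hx0]
            simp only [pieceBound]
            linarith [(hA _ hxS).1]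
          · exact hlow _ j hj0 (Function.update_of_ne hji _ _)
        · by_cases hj0 : j = 0
          · subst hj0
            rw [hupp0, hx0]
            simp only [pieceBound]
            linarith [(hB _ hxS).1]
          · by_cases hji : j = i
            · subst hji
              simp [pieceFunctional, pieceBound, h0]
            · exact hupp _ j hj hj0 (Function.update_of_ne hji _ _)
  · by_cases h0 : i = 0
    · subst h0
      refine ⟨Function.update c 0 (1 + ∑ i ∈ S, (1 - (i : ℕ) / n : ℝ) * c i), ?_, ?_⟩
      · rw [hupp0, hsum]; simp [pieceBound]
      · rintro (j | ⟨j, hj⟩) hne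
        · by_cases hj0 : j = 0
          · subst hj0
            rw [hlow0, hsum, Function.update_self]
            simp only [pieceBound]
            linarith
          · exact hlow _ j hj0 (Function.update_of_ne hj0 _ _)
        · have hj0 : j ≠ 0 := fun h => hne (by simp [h])
          exact hupp _ j hj hj0 (Function.update_of_ne hj0 _ _)
    · have hxS : ∀ j ∈ S, -(1 / (4 * n)) ≤ Function.update c i 1 j ∧
          Function.update c i 1 j ≤ 0 := fun j hj => by
        rw [Function.update_of_ne (ne_of_mem_of_not_mem hj hi)]
        exact hcS j hj
      have hx0 : Function.update c i 1 0 = 1 / 2 := by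
        rw [Function.update_of_ne (Ne.symm h0), hc0]
      refine ⟨Function.update c i 1, by simp [pieceFunctional, pieceBound, h0], ?_⟩
      rintro (j | ⟨j, hj⟩) hne
      · by_cases hj0 : j = 0
        · subst hj0
          rw [hlow0, hx0]
          simp only [pieceBound]
          linarith [(hA _ hxS).1]
        · by_cases hji : j = i
          · subst hji
            simp [pieceFunctional, pieceBound, h0, hi]
          · exact hlow _ j hj0 (Function.update_of_ne hji _ _)
      · have hji : j ≠ i := fun h => hne (by simp [h])
        by_cases hj0 : j = 0
        · subst hj0
          rw [hupp0, hx0]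
          simp only [pieceBound]
          linarith [(hB _ hxS).1]
        · exact hupp _ j hj hj0 (Function.update_of_ne hji _ _)

end Piece

/-- for `n ≥ 2` and `S ⊆ {2,…,n}` of cardinality `r`, the piece
`G_n^{0,S}` has exactly `2n − r` facets (matching the facet count of
`Δ^{r+1} × I^{n−r−1}`). -/
theorem stmt10 (n r : ℕ) [NeZero n] (hn : 2 ≤ n) (S : Finset (Fin n))
    (hS : (0 : Fin n) ∉ S) (hr : S.card = r) :
    {F : Set (Fin n → ℝ) | IsFacet n (Gpiece n 0 S) F}.ncard = 2 * n - r := by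
  have : Nontrivial (Fin n ⊕ {i // i ∉ S}) := ⟨.inl 0, .inr ⟨0, hS⟩, by simp⟩
  have hle : S.card ≤ n := S.card_le_univ.trans_eq (by simp)
  rw [Gpiece_zero_eq_polyhedron S hS, (irredundant_piece S hS).ncard_facets,
    Nat.card_eq_fintype_card, Fintype.card_sum, Fintype.card_subtype_compl, Fintype.card_fin,
    Fintype.card_coe]
  omega
end
end

section
/- Let n ≥ 2 and let ε be a real number with 0 ≤ ε ≤ 1/2. Define r : ℝⁿ → ℝⁿ by r(x) = (x_1, max(x_2, 0), …, max(x_n, 0)). Then: (1) the unit cube [0,1]ⁿ is contained in G_n^ε; (2) r maps G_n^ε into [0,1]ⁿ; (3) r fixes [0,1]ⁿ pointwise; and (4) for every x ∈ G_n^ε and t ∈ [0,1], the point (1−t)·x + t·r(x) lies in G_n^ε. Consequently the unit cube [0,1]ⁿ (the underlying space of the freehedron F_n) is a strong deformation retract of the Goodwillie polytope G_n^ε. -/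
open Set

noncomputable section

/-- The unit cube `[0,1]ⁿ`, the underlying space of the freehedron `F_n`. -/
def cube (n : ℕ) : Set (Fin n → ℝ) := {x | ∀ j, x j ∈ Set.Icc (0 : ℝ) 1}

/-- The retraction `r(x) = (x₁, max(x₂,0), …, max(x_n,0))`. -/
def retr (n : ℕ) [NeZero n] (x : Fin n → ℝ) : Fin n → ℝ :=
  fun j => if j = 0 then x 0 else max (x j) 0

theorem cube_eq_convexHull_Vcube (n : ℕ) : cube n = convexHull ℝ (Vcube n) := by
  have hV : Vcube n = Set.univ.pi fun _ => ({0, 1} : Set ℝ) := by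
    ext x
    simp [Vcube]
  rw [hV, convexHull_pi]
  ext x
  simp only [cube, mem_ofPred_eq, mem_univ_pi, convexHull_pair, segment_eq_Icc zero_le_one]

theorem cube_subset_Gpoly (n : ℕ) [NeZero n] (ε : ℝ) : cube n ⊆ Gpoly n ε := by
  rw [cube_eq_convexHull_Vcube]
  exact convexHull_mono subset_union_left

/-- The first coordinate of a point of the polytope is nonnegative, and all coordinates are at
most `1`. -/
theorem Gpoly_subset_bounds (n : ℕ) [NeZero n] {ε : ℝ} (hε0 : 0 ≤ ε) (hε1 : ε ≤ 1) :
    Gpoly n ε ⊆ {x | 0 ≤ x 0 ∧ ∀ j, x j ≤ 1} := by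
  refine convexHull_min ?_ ?_
  · rintro x (hx | ⟨i, -, hx0, hxi, hx⟩)
    · refine ⟨?_, fun j => ?_⟩
      · rcases hx 0 with h | h <;> simp [h]
      · rcases hx j with h | h <;> simp [h]
    · refine ⟨hx0 ▸ by positivity, fun j => ?_⟩
      by_cases hj0 : j = 0
      · rw [hj0, hx0]
        exact div_le_one_of_le₀ (by exact_mod_cast i.isLt.le) (by positivity)
      by_cases hji : j = i
      · rw [hji, hxi]
        norm_num
      · rcases hx j hj0 hji with h | h <;> linarith
  · rintro x ⟨hx0, hx⟩ y ⟨hy0, hy⟩ a b ha hb hab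
    exact ⟨convex_Ici (0 : ℝ) hx0 hy0 ha hb hab,
      fun j => convex_Iic (1 : ℝ) (hx j) (hy j) ha hb hab⟩

theorem retr_mem_cube (n : ℕ) [NeZero n] {ε : ℝ} (hε0 : 0 ≤ ε) (hε1 : ε ≤ 1)
    {x : Fin n → ℝ} (hx : x ∈ Gpoly n ε) : retr n x ∈ cube n := by
  obtain ⟨h0, h1⟩ := Gpoly_subset_bounds n hε0 hε1 hx
  intro j
  by_cases hj : j = 0
  · simpa [retr, hj] using ⟨h0, h1 0⟩
  · simpa [retr, hj] using h1 j

theorem retr_eq_self (n : ℕ) [NeZero n] {x : Fin n → ℝ} (hx : x ∈ cube n) :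
    retr n x = x := by
  ext j
  by_cases hj : j = 0
  · simp [retr, hj]
  · simp [retr, hj, (hx j).1]

theorem continuous_retr (n : ℕ) [NeZero n] : Continuous (retr n) := by
  refine continuous_pi fun j => ?_
  by_cases hj : j = 0
  · simpa [retr, hj] using continuous_apply (0 : Fin n)
  · simpa [retr, hj] using (continuous_apply j).max continuous_const

theorem segment_retr_mem_Gpoly (n : ℕ) [NeZero n] {ε : ℝ} (hε0 : 0 ≤ ε) (hε1 : ε ≤ 1)
    {x : Fin n → ℝ} (hx : x ∈ Gpoly n ε) {t : ℝ} (ht : t ∈ Set.Icc (0 : ℝ) 1) :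
    (1 - t) • x + t • retr n x ∈ Gpoly n ε :=
  convex_convexHull ℝ _ hx (cube_subset_Gpoly n ε (retr_mem_cube n hε0 hε1 hx))
    (sub_nonneg.2 ht.2) ht.1 (sub_add_cancel 1 t)

/-- for `n ≥ 2` and `0 ≤ ε ≤ 1/2`, with
`r(x) = (x₁, max(x₂,0), …, max(x_n,0))`: (1) the unit cube is contained in
`G_n^ε`; (2) `r` maps `G_n^ε` into the cube; (3) `r` fixes the cube
pointwise; (4) segments from `x` to `r(x)` stay in `G_n^ε`.  Consequently the
cube (the freehedron `F_n`) is a strong deformation retract of `G_n^ε`. -/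
theorem stmt15 (n : ℕ) [NeZero n] (hn : 2 ≤ n) (ε : ℝ) (hε0 : 0 ≤ ε) (hε1 : ε ≤ 1 / 2) :
    cube n ⊆ Gpoly n ε ∧
    (∀ x ∈ Gpoly n ε, retr n x ∈ cube n) ∧
    (∀ x ∈ cube n, retr n x = x) ∧
    (∀ x ∈ Gpoly n ε, ∀ t ∈ Set.Icc (0 : ℝ) 1, (1 - t) • x + t • retr n x ∈ Gpoly n ε) ∧
    ∃ H : ℝ × (Fin n → ℝ) → (Fin n → ℝ), Continuous H ∧
      (∀ x ∈ Gpoly n ε, H (0, x) = x) ∧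
      (∀ x ∈ Gpoly n ε, H (1, x) ∈ cube n) ∧
      (∀ t ∈ Set.Icc (0 : ℝ) 1, ∀ x ∈ Gpoly n ε, H (t, x) ∈ Gpoly n ε) ∧
      (∀ t ∈ Set.Icc (0 : ℝ) 1, ∀ q ∈ cube n, H (t, q) = q) := by
  have hε : ε ≤ 1 := by linarith
  refine ⟨cube_subset_Gpoly n ε, fun x hx => retr_mem_cube n hε0 hε hx,
    fun x hx => retr_eq_self n hx, fun x hx t ht => segment_retr_mem_Gpoly n hε0 hε hx ht,
    fun p => (1 - p.1) • p.2 + p.1 • retr n p.2, ?_, ?_, ?_, ?_, ?_⟩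
  · have := continuous_retr n
    fun_prop
  · intro x _
    simp
  · intro x hx
    simpa using retr_mem_cube n hε0 hε hx
  · exact fun t ht x hx => segment_retr_mem_Gpoly n hε0 hε hx ht
  · intro t _ q hq
    simp only [retr_eq_self n hq, ← add_smul, sub_add_cancel, one_smul]
end
end
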